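/- arXiv:2510.18896 — 5 statements merged into one kernel-verified Lean document; each statement's English description precedes it below -/
import Mathlib

section
/- In the three-person society with capacities (1, 2, 3), all justice parameters α_i = 0 (desert-based), imposed level α = 1 (equal distribution), and initial productivities (1, 2, 3), the taxation dynamics satisfy p(1) = (1, 2, 2) and, for all t ≥ 2, p(t) = (1, 1 + (2/3)^{t−1}, 1 + (2/3)^{t−1}). -/
/-- One step of the taxation dynamics: individual `i` with capacity `a i` and
justice parameter `αs i`, under imposed level `α`, updates productivity to
`max 0 (min (a i) (p i + (α − αs i) * (P − p i)))`, where `P` is the average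
production. -/
noncomputable def step {n : ℕ} (a αs : Fin n → ℝ) (α : ℝ) (p : Fin n → ℝ) :
    Fin n → ℝ :=
  fun i => max 0 (min (a i) (p i + (α - αs i) * ((∑ j, p j) / n - p i)))

/-- The trajectory of the taxation dynamics from initial productivities `p0`. -/
noncomputable def traj {n : ℕ} (a αs : Fin n → ℝ) (α : ℝ) (p0 : Fin n → ℝ) :
    ℕ → Fin n → ℝ
  | 0 => p0
  | t + 1 => step a αs α (traj a αs α p0 t)

lemma step_aux (x : ℝ) (h0 : 0 ≤ x) (h1 : x ≤ 1) :
    step ![1, 2, 3] ![0, 0, 0] 1 ![1, 1 + x, 1 + x]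
      = ![1, 1 + x * (2 / 3), 1 + x * (2 / 3)] := by
  funext i
  have e : (1 + (1 + x) + (1 + x)) / 3 = 1 + x * (2 / 3) := by ring
  have p0 : 0 ≤ 1 + x * (2 / 3) := by linarith
  have m1 : min 1 (1 + x * (2 / 3)) = 1 := min_eq_left (by linarith)
  have m2 : min 2 (1 + x * (2 / 3)) = 1 + x * (2 / 3) := min_eq_right (by linarith)
  have m3 : min 3 (1 + x * (2 / 3)) = 1 + x * (2 / 3) := min_eq_right (by linarith)
  fin_cases i <;> simp [step, Fin.sum_univ_three, -le_add_iff_nonneg_right] <;> rw [e]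
  · rw [m1]
    norm_num
  · rw [m2, max_eq_right p0]
  · rw [m3, max_eq_right p0]

/-- three-person society, capacities `(1,2,3)`, all justice
parameters `0` (desert-based), imposed level `1` (equal distribution), initial
productivities `(1,2,3)`: then `p(1) = (1,2,2)` and for all `t ≥ 2`,
`p(t) = (1, 1 + (2/3)^(t−1), 1 + (2/3)^(t−1))`. -/
theorem case_all_D_E_imposed :
    traj ![1, 2, 3] ![0, 0, 0] 1 ![1, 2, 3] 1 = ![1, 2, 2] ∧
    ∀ t : ℕ, 2 ≤ t →
      traj ![1, 2, 3] ![0, 0, 0] 1 ![1, 2, 3] t =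
        ![1, 1 + (2 / 3 : ℝ) ^ (t - 1), 1 + (2 / 3 : ℝ) ^ (t - 1)] := by
  have h1 : traj ![1, 2, 3] ![0, 0, 0] 1 ![1, 2, 3] 1 = ![1, 2, 2] := by
    funext i
    fin_cases i <;> simp [traj, step, Fin.sum_univ_three] <;> norm_num
  have h2 : ∀ t : ℕ, traj ![1, 2, 3] ![0, 0, 0] 1 ![1, 2, 3] (t + 1) =
        ![1, 1 + (2 / 3 : ℝ) ^ t, 1 + (2 / 3 : ℝ) ^ t] := by
    intro t
    induction t with
    | zero =>
      rw [h1]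
      norm_num
    | succ k ih =>
      rw [traj, ih, step_aux _ (by positivity) (pow_le_one₀ (by norm_num) (by norm_num)),
        pow_succ]
  refine ⟨h1, fun t ht => ?_⟩
  obtain ⟨k, rfl⟩ : ∃ k, t = k + 1 := ⟨t - 1, by omega⟩
  exact h2 k
end

section
/- In the three-person society with capacities (1, 2, 3), all justice parameters α_i = 0, imposed level α = 1, and initial productivities (1, 2, 3), the productivities converge to (1, 1, 1) as t → ∞, but the limit is never attained: p_2(t) > 1 and p_3(t) > 1 for every t. -/
theorem traj_closed_form (t : ℕ) :
    traj ![1, 2, 3] ![0, 0, 0] 1 ![1, 2, 3] (t + 1) =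
      ![1, 1 + (2 / 3 : ℝ) ^ t, 1 + (2 / 3 : ℝ) ^ t] := by
  have key : ∀ (p : Fin 3 → ℝ) (x : ℝ), 0 < x → x ≤ 1 → p 0 + p 1 + p 2 = 3 + 3 * x →
      step ![1, 2, 3] ![0, 0, 0] 1 p = ![1, 1 + x, 1 + x] := by
    intro p x h0 h1 hs
    have hP : (p 0 + p 1 + p 2) / 3 = 1 + x := by rw [hs]; ring
    have e0 : min (1 : ℝ) (1 + x) = 1 := min_eq_left (by linarith)
    have e1 : min (2 : ℝ) (1 + x) = 1 + x := min_eq_right (by linarith)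
    have e2 : min (3 : ℝ) (1 + x) = 1 + x := min_eq_right (by linarith)
    have e3 : max (0 : ℝ) (1 + x) = 1 + x := max_eq_right (by linarith)
    funext i
    fin_cases i <;> simp [step, Fin.sum_univ_three, hP, e0, e1, e2, e3]
  induction t with
  | zero =>
    rw [traj, traj]
    rw [key _ 1 (by norm_num) le_rfl (by simp; norm_num)]
    simp
  | succ k ih =>
    rw [traj, ih]
    refine key _ _ (by positivity) (pow_le_one₀ (by norm_num) (by norm_num)) ?_
    simp
    ring

/-- three-person society, capacities `(1,2,3)`, all justice
parameters `0`, imposed level `1`, initial productivities `(1,2,3)`: the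
productivities converge to `(1,1,1)` as `t → ∞`, but the limit is never
attained: `p_2(t) > 1` and `p_3(t) > 1` for every `t`. -/
theorem case_all_D_E_imposed_limit :
    Filter.Tendsto (fun t => traj ![1, 2, 3] ![0, 0, 0] 1 ![1, 2, 3] t)
      Filter.atTop (nhds ![1, 1, 1]) ∧
    ∀ t : ℕ, 1 < traj ![1, 2, 3] ![0, 0, 0] 1 ![1, 2, 3] t 1 ∧
      1 < traj ![1, 2, 3] ![0, 0, 0] 1 ![1, 2, 3] t 2 := by
  constructor
  · rw [← Filter.tendsto_add_atTop_iff_nat 1]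
    simp only [traj_closed_form]
    have h : Filter.Tendsto (fun t : ℕ => 1 + (2 / 3 : ℝ) ^ t) Filter.atTop (nhds 1) := by
      simpa using (tendsto_pow_atTop_nhds_zero_of_lt_one
        (by norm_num : (0 : ℝ) ≤ 2 / 3) (by norm_num)).const_add 1
    rw [tendsto_pi_nhds]
    intro i
    fin_cases i
    · simp
    · simpa using h
    · simpa using h
  · intro t
    cases t with
    | zero => simp [traj]
    | succ k =>
      rw [traj_closed_form]
      have : (0 : ℝ) < (2 / 3 : ℝ) ^ k := by positivity
      constructor
      · simpa using this
      · simpa using this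
end

section
/- In the three-person society with capacities (1, 2, 3), justice parameters α_1 = α_2 = 1 and α_3 = 0, imposed level α = 1, and initial productivities (1, 2, 3): p_1(t) = 1 and p_2(t) = 2 for all t, and p_3(t) = (3/2)·(1 + 3^{−t}) for all t ≥ 0; consequently p_3(t) converges to 3/2 but p_3(t) > 3/2 for every t. -/
/-- three-person society, capacities `(1,2,3)`, justice parameters
`α_1 = α_2 = 1`, `α_3 = 0`, imposed level `1`, initial productivities `(1,2,3)`:
`p_1(t) = 1` and `p_2(t) = 2` for all `t`, and `p_3(t) = (3/2)·(1 + 3^(−t))` for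
all `t ≥ 0`; consequently `p_3(t)` converges to `3/2` but `p_3(t) > 3/2` for
every `t`. -/
theorem case_two_E_one_D_E_imposed :
    (∀ t : ℕ, traj ![1, 2, 3] ![1, 1, 0] 1 ![1, 2, 3] t 0 = 1 ∧
      traj ![1, 2, 3] ![1, 1, 0] 1 ![1, 2, 3] t 1 = 2) ∧
    (∀ t : ℕ, traj ![1, 2, 3] ![1, 1, 0] 1 ![1, 2, 3] t 2 =
      (3 / 2 : ℝ) * (1 + ((3 : ℝ) ^ t)⁻¹)) ∧
    Filter.Tendsto (fun t => traj ![1, 2, 3] ![1, 1, 0] 1 ![1, 2, 3] t 2)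
      Filter.atTop (nhds (3 / 2)) ∧
    ∀ t : ℕ, (3 / 2 : ℝ) < traj ![1, 2, 3] ![1, 1, 0] 1 ![1, 2, 3] t 2 := by
  have key : ∀ t : ℕ, traj ![1, 2, 3] ![1, 1, 0] 1 ![1, 2, 3] t 0 = 1 ∧
      traj ![1, 2, 3] ![1, 1, 0] 1 ![1, 2, 3] t 1 = 2 ∧
      traj ![1, 2, 3] ![1, 1, 0] 1 ![1, 2, 3] t 2 =
      (3 / 2 : ℝ) * (1 + ((3 : ℝ) ^ t)⁻¹) := by
    intro t
    induction t with
    | zero => refine ⟨by simp [traj], by simp [traj], ?_⟩; simp only [traj, Matrix.cons_val]; norm_num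
    | succ t ih =>
      obtain ⟨h0, h1, h2⟩ := ih
      have hp : (0 : ℝ) < ((3 : ℝ) ^ t)⁻¹ := by positivity
      have hle : ((3 : ℝ) ^ t)⁻¹ ≤ 1 := inv_le_one_of_one_le₀ (one_le_pow₀ (by norm_num))
      have e : ((3 : ℝ) ^ (t + 1))⁻¹ = ((3 : ℝ) ^ t)⁻¹ / 3 := by
        rw [pow_succ, mul_inv]; ring
      refine ⟨?_, ?_, ?_⟩
      · simp [traj, step, h0]
      · simp [traj, step, h1]
      · rw [e]
        simp only [traj, step, Fin.sum_univ_three, h0, h1, h2]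
        generalize ((3 : ℝ) ^ t)⁻¹ = x at hp hle
        simp only [Matrix.cons_val]
        push_cast
        rw [min_eq_right (by linarith), max_eq_right (by linarith)]
        ring
  refine ⟨fun t => ⟨(key t).1, (key t).2.1⟩, fun t => (key t).2.2, ?_, ?_⟩
  · simp_rw [fun t => (key t).2.2]
    have h : Filter.Tendsto (fun t : ℕ => ((3 : ℝ) ^ t)⁻¹) Filter.atTop (nhds 0) :=
      tendsto_inv_atTop_zero.comp (tendsto_pow_atTop_atTop_of_one_lt (by norm_num))
    simpa using (h.const_add 1).const_mul (3 / 2 : ℝ)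
  · intro t
    rw [(key t).2.2]
    have hp : (0 : ℝ) < ((3 : ℝ) ^ t)⁻¹ := by positivity
    linarith
end

section
/- Let p with 0 ≤ p_i ≤ a_i be a fixed point of the taxation dynamics whose average P = (Σ_j p_j)/n is strictly positive, and assume α_i ≠ α for all i. Then every liberal (α_i < α) satisfies either p_i = P or p_i = a_i ≤ P (i.e. p_i = min(a_i, P)), and every socialist (α_i > α) satisfies p_i = 0, or p_i = P, or p_i = a_i ≥ P. -/
/-- let `p` with `0 ≤ p_i ≤ a_i` be a fixed point of the taxation
dynamics whose average `P = (Σ_j p_j)/n` is strictly positive, and assume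
`α_i ≠ α` for all `i`. Then every liberal (`α_i < α`) satisfies `p_i = P` or
`p_i = a_i ≤ P`, and every socialist (`α_i > α`) satisfies `p_i = 0`, or
`p_i = P`, or `p_i = a_i ≥ P`. -/
theorem fixed_point_structure {n : ℕ} (a αs : Fin n → ℝ) (α : ℝ) (p : Fin n → ℝ)
    (hp : ∀ i, 0 ≤ p i ∧ p i ≤ a i)
    (hfix : step a αs α p = p)
    (hP : 0 < (∑ j, p j) / n)
    (hne : ∀ i, αs i ≠ α) :
    (∀ i, αs i < α →
      p i = (∑ j, p j) / n ∨ (p i = a i ∧ a i ≤ (∑ j, p j) / n)) ∧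
    (∀ i, α < αs i →
      p i = 0 ∨ p i = (∑ j, p j) / n ∨ (p i = a i ∧ (∑ j, p j) / n ≤ a i)) := by
  have key : ∀ i, max 0 (min (a i) (p i + (α - αs i) * ((∑ j, p j) / n - p i))) = p i :=
    fun i => congrFun hfix i
  generalize (∑ j, p j) / (n : ℝ) = P at *
  -- a positive productivity cannot be strictly pushed down
  have down : ∀ i, 0 < p i → ¬ ((α - αs i) * (P - p i) < 0) := by
    intro i h0 h
    have h1 : max 0 (min (a i) (p i + (α - αs i) * (P - p i))) < p i :=
      max_lt h0 (lt_of_le_of_lt (min_le_right _ _) (by linarith))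
    exact absurd (key i) h1.ne
  -- a productivity pushed up must be saturated
  have up : ∀ i, 0 < (α - αs i) * (P - p i) → p i = a i := by
    intro i h
    by_contra hn
    have h1 : p i < max 0 (min (a i) (p i + (α - αs i) * (P - p i))) :=
      lt_max_of_lt_right (lt_min (lt_of_le_of_ne (hp i).2 hn) (by linarith))
    exact absurd (key i) h1.ne'
  refine ⟨fun i hi => ?_, fun i hi => ?_⟩
  · rcases lt_trichotomy (p i) P with h | h | h
    · have e := up i (mul_pos (by linarith) (by linarith))
      exact Or.inr ⟨e, by linarith⟩
    · exact Or.inl h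
    · exact absurd (mul_neg_of_pos_of_neg (by linarith) (by linarith)) (down i (by linarith))
  · rcases (hp i).1.eq_or_lt with h0 | h0
    · exact Or.inl h0.symm
    rcases lt_trichotomy (p i) P with h | h | h
    · exact absurd (mul_neg_of_neg_of_pos (by linarith) (by linarith)) (down i h0)
    · exact Or.inr (Or.inl h)
    · have e := up i (mul_pos_of_neg_of_neg (by linarith) (by linarith))
      exact Or.inr (Or.inr ⟨e, by linarith⟩)
end

section
/- In the five-person society with capacities a = (1, 2, 2, 4, 10), justice parameters (0.4, 0.6, 0.2, 0.1, 0.5), and imposed level α = 0.3, the set S of configurations p with 0 ≤ p_1 ≤ 1, 0 ≤ p_2 ≤ 2, p_3 = 2, 3 ≤ p_4 ≤ 4, p_5 = 10 is invariant under the taxation dynamics; moreover on S the updates satisfy p_1' ≤ p_1 and p_2' ≤ p_2. In particular, starting from full capacity (1, 2, 2, 4, 10), individual 5 produces 10 and individual 3 produces 2 at every time step, while the productivities of individuals 1 and 2 are non-increasing. -/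
/-- The invariant set `S` of configurations: `0 ≤ p_1 ≤ 1`, `0 ≤ p_2 ≤ 2`,
`p_3 = 2`, `3 ≤ p_4 ≤ 4`, `p_5 = 10`. -/
def S : Set (Fin 5 → ℝ) :=
  {p | 0 ≤ p 0 ∧ p 0 ≤ 1 ∧ 0 ≤ p 1 ∧ p 1 ≤ 2 ∧ p 2 = 2 ∧ 3 ≤ p 3 ∧ p 3 ≤ 4 ∧
    p 4 = 10}

/-- five-person society with capacities `(1,2,2,4,10)`, justice
parameters `(0.4, 0.6, 0.2, 0.1, 0.5)`, imposed level `0.3`: the set `S` is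
invariant under the taxation dynamics, and on `S` the updates satisfy
`p_1' ≤ p_1` and `p_2' ≤ p_2`. In particular, starting from full capacity
`(1,2,2,4,10)`, individual 5 produces `10` and individual 3 produces `2` at
every time step, while the productivities of individuals 1 and 2 are
non-increasing. -/
theorem invariant_set_dynamics :
    (∀ p ∈ S,
      step ![1, 2, 2, 4, 10] ![0.4, 0.6, 0.2, 0.1, 0.5] 0.3 p ∈ S ∧
      step ![1, 2, 2, 4, 10] ![0.4, 0.6, 0.2, 0.1, 0.5] 0.3 p 0 ≤ p 0 ∧
      step ![1, 2, 2, 4, 10] ![0.4, 0.6, 0.2, 0.1, 0.5] 0.3 p 1 ≤ p 1) ∧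
    (∀ t : ℕ,
      traj ![1, 2, 2, 4, 10] ![0.4, 0.6, 0.2, 0.1, 0.5] 0.3 ![1, 2, 2, 4, 10] t 4 = 10 ∧
      traj ![1, 2, 2, 4, 10] ![0.4, 0.6, 0.2, 0.1, 0.5] 0.3 ![1, 2, 2, 4, 10] t 2 = 2 ∧
      traj ![1, 2, 2, 4, 10] ![0.4, 0.6, 0.2, 0.1, 0.5] 0.3 ![1, 2, 2, 4, 10] (t + 1) 0 ≤
        traj ![1, 2, 2, 4, 10] ![0.4, 0.6, 0.2, 0.1, 0.5] 0.3 ![1, 2, 2, 4, 10] t 0 ∧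
      traj ![1, 2, 2, 4, 10] ![0.4, 0.6, 0.2, 0.1, 0.5] 0.3 ![1, 2, 2, 4, 10] (t + 1) 1 ≤
        traj ![1, 2, 2, 4, 10] ![0.4, 0.6, 0.2, 0.1, 0.5] 0.3 ![1, 2, 2, 4, 10] t 1) := by
  have key : ∀ p ∈ S,
      step ![1, 2, 2, 4, 10] ![0.4, 0.6, 0.2, 0.1, 0.5] 0.3 p ∈ S ∧
      step ![1, 2, 2, 4, 10] ![0.4, 0.6, 0.2, 0.1, 0.5] 0.3 p 0 ≤ p 0 ∧
      step ![1, 2, 2, 4, 10] ![0.4, 0.6, 0.2, 0.1, 0.5] 0.3 p 1 ≤ p 1 := by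
    rintro p ⟨h0, h0', h1, h1', h2, h3, h3', h4⟩
    obtain ⟨P, hP⟩ : ∃ P : ℝ, P = (∑ j, p j) / (5 : ℕ) := ⟨_, rfl⟩
    have hP' : P = (p 0 + p 1 + p 2 + p 3 + p 4) / 5 := by
      rw [hP, Fin.sum_univ_five]; norm_num
    have e0 : step ![1, 2, 2, 4, 10] ![0.4, 0.6, 0.2, 0.1, 0.5] 0.3 p 0
        = max 0 (min 1 (p 0 + (0.3 - 0.4) * (P - p 0))) := by rw [hP]; rfl
    have e1 : step ![1, 2, 2, 4, 10] ![0.4, 0.6, 0.2, 0.1, 0.5] 0.3 p 1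
        = max 0 (min 2 (p 1 + (0.3 - 0.6) * (P - p 1))) := by rw [hP]; rfl
    have e2 : step ![1, 2, 2, 4, 10] ![0.4, 0.6, 0.2, 0.1, 0.5] 0.3 p 2
        = max 0 (min 2 (p 2 + (0.3 - 0.2) * (P - p 2))) := by rw [hP]; rfl
    have e3 : step ![1, 2, 2, 4, 10] ![0.4, 0.6, 0.2, 0.1, 0.5] 0.3 p 3
        = max 0 (min 4 (p 3 + (0.3 - 0.1) * (P - p 3))) := by rw [hP]; rfl
    have e4 : step ![1, 2, 2, 4, 10] ![0.4, 0.6, 0.2, 0.1, 0.5] 0.3 p 4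
        = max 0 (min 10 (p 4 + (0.3 - 0.5) * (P - p 4))) := by rw [hP]; rfl
    have hPl : 3 ≤ P := by linarith
    have hPu : P ≤ 4 := by linarith
    refine ⟨⟨?_, ?_, ?_, ?_, ?_, ?_, ?_, ?_⟩, ?_, ?_⟩
    · rw [e0]; exact le_max_left _ _
    · rw [e0]; exact max_le (by norm_num) (min_le_left _ _)
    · rw [e1]; exact le_max_left _ _
    · rw [e1]; exact max_le (by norm_num) (min_le_left _ _)
    · rw [e2, min_eq_left (by norm_num; linarith)]; norm_num
    · rw [e3]; exact le_max_of_le_right (le_min (by norm_num) (by norm_num; linarith))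
    · rw [e3]; exact max_le (by norm_num) (min_le_left _ _)
    · rw [e4, min_eq_left (by norm_num; linarith)]; norm_num
    · rw [e0]; exact max_le h0 (min_le_of_right_le (by norm_num; linarith))
    · rw [e1]; exact max_le h1 (min_le_of_right_le (by norm_num; linarith))
  have inv : ∀ t : ℕ,
      traj ![1, 2, 2, 4, 10] ![0.4, 0.6, 0.2, 0.1, 0.5] 0.3 ![1, 2, 2, 4, 10] t ∈ S := by
    intro t
    induction t with
    | zero => simp [traj, S]; norm_num
    | succ t ih => exact (key _ ih).1
  refine ⟨key, fun t => ?_⟩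
  have h := inv t
  obtain ⟨_, _, _, _, h2, _, _, h4⟩ := inv t
  exact ⟨h4, h2, (key _ h).2.1, (key _ h).2.2⟩
end
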